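/- arXiv:1805.12481 — 5 statements merged into one kernel-verified Lean document; each statement's English description precedes it below -/
import Mathlib

section
/- For all natural numbers l and m, the integral over [-1,1] of P_l(ξ) multiplied by the derivative of P_m(ξ) equals 2 if l < m and l + m is odd, and equals 0 otherwise. -/
open Polynomial intervalIntegral

/-- The degree-`n` Legendre polynomial of the first kind on `[-1,1]`, defined by the
Rodrigues formula `P_n(x) = 1/(2^n n!) · dⁿ/dxⁿ (x² − 1)ⁿ`. -/
noncomputable def legendre (n : ℕ) : Polynomial ℝ :=
  Polynomial.C ((1 : ℝ) / (2 ^ n * n.factorial)) *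
    (Polynomial.derivative^[n] ((Polynomial.X ^ 2 - 1) ^ n))

/-- The `n`-th derivative of `(X - a)ⁿ g` takes the value `n! g(a)` at `a`. -/
theorem eval_iterate_derivative_X_sub_C_pow_mul (a : ℝ) (n : ℕ) (g : ℝ[X]) :
    (derivative^[n] ((X - C a) ^ n * g)).eval a = n.factorial * g.eval a := by
  induction n generalizing g with
  | zero => simp
  | succ n ih =>
    have h : derivative ((X - C a) ^ (n + 1) * g) =
        (X - C a) ^ n * (C ((n : ℝ) + 1) * g + (X - C a) * derivative g) := by
      rw [derivative_mul, derivative_X_sub_C_pow]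
      simp only [Nat.cast_add, Nat.cast_one, map_add, map_natCast, map_one, Nat.add_sub_cancel]
      ring
    rw [Function.iterate_succ_apply, h, ih, Nat.factorial_succ]
    simp
    ring

theorem eval_iterate_derivative_X_sub_C_pow_mul_of_lt (a : ℝ) {k n : ℕ} (hk : k < n)
    (g : ℝ[X]) : (derivative^[k] ((X - C a) ^ n * g)).eval a = 0 := by
  obtain ⟨d, rfl⟩ := Nat.exists_eq_add_of_lt hk
  have h : (X - C a) ^ (k + d + 1) * g = (X - C a) ^ k * ((X - C a) ^ (d + 1) * g) := by ring
  rw [h, eval_iterate_derivative_X_sub_C_pow_mul]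
  simp

theorem X_sq_sub_one_pow_eq (n : ℕ) :
    ((X : ℝ[X]) ^ 2 - 1) ^ n = (X - C 1) ^ n * (X + 1) ^ n := by
  rw [← mul_pow, C_1]
  ring

theorem X_sq_sub_one_pow_eq' (n : ℕ) :
    ((X : ℝ[X]) ^ 2 - 1) ^ n = (X - C (-1)) ^ n * (X - 1) ^ n := by
  rw [← mul_pow, C_neg, C_1]
  ring

theorem legendre_eval_one (n : ℕ) : (legendre n).eval 1 = 1 := by
  rw [legendre, eval_mul, eval_C, X_sq_sub_one_pow_eq, eval_iterate_derivative_X_sub_C_pow_mul]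
  have := n.factorial_ne_zero
  simp only [eval_pow, eval_add, eval_X, eval_one, one_add_one_eq_two]
  field_simp

theorem legendre_eval_neg_one (n : ℕ) : (legendre n).eval (-1) = (-1) ^ n := by
  rw [legendre, eval_mul, eval_C, X_sq_sub_one_pow_eq', eval_iterate_derivative_X_sub_C_pow_mul]
  have := n.factorial_ne_zero
  have h : (-1 - 1 : ℝ) = (-1) * 2 := by norm_num
  simp only [eval_pow, eval_sub, eval_X, eval_one, h, mul_pow]
  field_simp

theorem iterate_derivative_legendre_eq_zero {n k : ℕ} (h : n < k) :
    derivative^[k] (legendre n) = 0 := by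
  apply iterate_derivative_eq_zero
  refine lt_of_le_of_lt ?_ h
  refine (natDegree_C_mul_le _ _).trans ((natDegree_iterate_derivative _ _).trans ?_)
  have h1 : (((X : ℝ[X]) ^ 2 - 1) ^ n).natDegree ≤ n * 2 :=
    natDegree_pow_le_of_le n (by compute_degree)
  omega

theorem Polynomial.integral_eval_mul_derivative (p q : ℝ[X]) (a b : ℝ) :
    ∫ x in a..b, p.eval x * (derivative q).eval x =
      p.eval b * q.eval b - p.eval a * q.eval a - ∫ x in a..b, (derivative p).eval x * q.eval x :=
  integral_mul_deriv_eq_deriv_mul (fun x _ => p.hasDerivAt x) (fun x _ => q.hasDerivAt x)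
    ((derivative p).continuous.intervalIntegrable _ _)
    ((derivative q).continuous.intervalIntegrable _ _)

theorem integral_eval_mul_iterate_derivative_eq_zero {n k : ℕ} (hk : k ≤ n) (q : ℝ[X])
    (hq : derivative^[k] q = 0) :
    ∫ x in (-1 : ℝ)..1, q.eval x * (derivative^[k] ((X ^ 2 - 1) ^ n)).eval x = 0 := by
  induction k generalizing q with
  | zero =>
    obtain rfl : q = 0 := hq
    simp
  | succ k ih =>
    have h1 : (derivative^[k] (((X : ℝ[X]) ^ 2 - 1) ^ n)).eval 1 = 0 := by
      rw [X_sq_sub_one_pow_eq, eval_iterate_derivative_X_sub_C_pow_mul_of_lt _ hk]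
    have h2 : (derivative^[k] (((X : ℝ[X]) ^ 2 - 1) ^ n)).eval (-1) = 0 := by
      rw [X_sq_sub_one_pow_eq', eval_iterate_derivative_X_sub_C_pow_mul_of_lt _ hk]
    rw [Function.iterate_succ_apply', Polynomial.integral_eval_mul_derivative, h1, h2,
      ih (by omega) _ hq]
    simp

/-- `P_n` is orthogonal to every polynomial whose `n`-th derivative vanishes. -/
theorem integral_eval_mul_legendre_eq_zero {n : ℕ} (q : ℝ[X]) (hq : derivative^[n] q = 0) :
    ∫ x in (-1 : ℝ)..1, q.eval x * (legendre n).eval x = 0 := by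
  simp only [legendre, eval_mul, eval_C, mul_left_comm (q.eval _)]
  rw [intervalIntegral.integral_const_mul,
    integral_eval_mul_iterate_derivative_eq_zero le_rfl q hq, mul_zero]

theorem legendre_integral_mul_deriv (l m : ℕ) :
    (∫ ξ in (-1:ℝ)..1, (legendre l).eval ξ * ((Polynomial.derivative (legendre m)).eval ξ)) =
      if l < m ∧ Odd (l + m) then 2 else 0 := by
  rcases lt_or_ge l m with h | h
  · have h0 : derivative^[m] (derivative (legendre l)) = 0 :=
      iterate_derivative_legendre_eq_zero (k := m + 1) (by omega)
    rw [Polynomial.integral_eval_mul_derivative, integral_eval_mul_legendre_eq_zero _ h0]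
    simp only [legendre_eval_one, legendre_eval_neg_one, ← pow_add, h, true_and]
    split_ifs with ho
    · rw [ho.neg_one_pow]
      norm_num
    · rw [(Nat.not_odd_iff_even.mp ho).neg_one_pow]
      norm_num
  · have h0 : derivative^[l] (derivative (legendre m)) = 0 :=
      iterate_derivative_legendre_eq_zero (k := l + 1) (by omega)
    rw [if_neg (by omega)]
    simpa only [mul_comm] using integral_eval_mul_legendre_eq_zero _ h0
end

section
/- Let p ≥ 1 and let h be a real polynomial of degree at most p+1 with Legendre expansion h = Σ_{i=0}^{p+1} h̃_i P_i. Then h satisfies the GLSFR condition of order p if and only if for every m with 1 ≤ m ≤ p, the sum Σ h̃_i over all indices i with i < m and i + m odd equals 0. -/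
open Polynomial Finset

/-- A real polynomial `h` satisfies the GLSFR condition of order `p` if
`∫_{-1}^{1} h(ξ) u'(ξ) dξ = 0` for every real polynomial `u` of degree at most `p`. -/
def GLSFRCondition (p : ℕ) (h : Polynomial ℝ) : Prop :=
  ∀ u : Polynomial ℝ, u.natDegree ≤ p →
    (∫ ξ in (-1:ℝ)..1, h.eval ξ * ((Polynomial.derivative u).eval ξ)) = 0

theorem eval_iterate_derivative_X_sq_sub_one_pow {n j : ℕ} (hj : j < n) {x : ℝ}
    (hx : x ^ 2 = 1) : (derivative^[j] ((X ^ 2 - 1 : ℝ[X]) ^ n)).eval x = 0 := by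
  obtain ⟨q, hq⟩ := pow_sub_dvd_iterate_derivative_pow (X ^ 2 - 1 : ℝ[X]) n j
  rw [hq]
  simp [hx, Nat.sub_ne_zero_of_lt hj]

/-- Iterated integration by parts when all boundary terms vanish. -/
theorem integral_iterate_derivative_mul {a b : ℝ} (f : ℝ[X]) (n : ℕ)
    (ha : ∀ j < n, (derivative^[j] f).eval a = 0) (hb : ∀ j < n, (derivative^[j] f).eval b = 0)
    (q : ℝ[X]) :
    ∫ x in a..b, (derivative^[n] f).eval x * q.eval x =
      (-1) ^ n * ∫ x in a..b, f.eval x * (derivative^[n] q).eval x := by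
  induction n generalizing q with
  | zero => simp
  | succ n ih =>
    have parts := intervalIntegral.integral_mul_deriv_eq_deriv_mul (a := a) (b := b)
      (fun x _ ↦ q.hasDerivAt x) (fun x _ ↦ (derivative^[n] f).hasDerivAt x)
      ((derivative q).continuous.intervalIntegrable _ _)
      ((derivative (derivative^[n] f)).continuous.intervalIntegrable _ _)
    rw [ha n n.lt_succ_self, hb n n.lt_succ_self] at parts
    have step := ih (fun j hj ↦ ha j (hj.trans n.lt_succ_self))
      (fun j hj ↦ hb j (hj.trans n.lt_succ_self)) (derivative q)
    simp only [mul_comm (eval _ (derivative^[n] f))] at step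
    simp only [Function.iterate_succ_apply' derivative n f, mul_comm _ (eval _ q)]
    rw [parts, step, Function.iterate_succ_apply]
    ring

theorem integral_legendre_mul_eq_zero {n : ℕ} {q : ℝ[X]} (hq : q.degree < n) :
    ∫ x in (-1 : ℝ)..1, (legendre n).eval x * q.eval x = 0 := by
  simp only [legendre, eval_mul, eval_C, mul_assoc, intervalIntegral.integral_const_mul]
  rw [integral_iterate_derivative_mul _ n
    (fun j hj ↦ eval_iterate_derivative_X_sq_sub_one_pow hj (by norm_num))
    (fun j hj ↦ eval_iterate_derivative_X_sq_sub_one_pow hj (by norm_num)),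
    iterate_derivative_eq_zero_of_degree_lt hq]
  simp

theorem natDegree_X_sq_sub_one_pow (n : ℕ) : ((X ^ 2 - 1 : ℝ[X]) ^ n).natDegree = n + n := by
  rw [natDegree_pow, ← C_1, natDegree_X_pow_sub_C, mul_two]

theorem natDegree_legendre_le (n : ℕ) : (legendre n).natDegree ≤ n := by
  refine (natDegree_C_mul_le _ _).trans ((natDegree_iterate_derivative _ _).trans ?_)
  rw [natDegree_X_sq_sub_one_pow, Nat.add_sub_cancel]

theorem degree_legendre_lt {n m : ℕ} (h : n < m) : (legendre n).degree < m :=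
  (degree_le_of_natDegree_le (natDegree_legendre_le n)).trans_lt (by exact_mod_cast h)

theorem legendre_ne_zero (n : ℕ) : legendre n ≠ 0 := by
  refine mul_ne_zero (by simp [Nat.factorial_ne_zero]) fun h ↦ ?_
  have hc := congrArg (coeff · n) h
  have hm : ((X ^ 2 - 1 : ℝ[X]) ^ n).Monic := by
    rw [← C_1]
    exact (monic_X_pow_sub_C 1 two_ne_zero).pow n
  have hl := hm.coeff_natDegree
  rw [natDegree_X_sq_sub_one_pow] at hl
  simp only [coeff_iterate_derivative, hl, coeff_zero, nsmul_eq_mul, mul_one,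
    Nat.cast_eq_zero, Nat.descFactorial_eq_zero_iff_lt] at hc
  omega

theorem integral_legendre_mul_legendre_of_ne {i k : ℕ} (h : i ≠ k) :
    ∫ x in (-1 : ℝ)..1, (legendre i).eval x * (legendre k).eval x = 0 := by
  rcases h.lt_or_gt with h | h
  · simp only [mul_comm (eval _ (legendre i))]
    exact integral_legendre_mul_eq_zero (degree_legendre_lt h)
  · exact integral_legendre_mul_eq_zero (degree_legendre_lt h)

theorem integral_eval_mul_self_ne_zero {a b : ℝ} (hab : a < b) {q : ℝ[X]} (hq : q ≠ 0) :
    ∫ x in a..b, q.eval x * q.eval x ≠ 0 := by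
  obtain ⟨c, hc, hqc⟩ : ∃ c ∈ Set.Icc a b, q.eval c ≠ 0 := by
    by_contra! h
    exact hq (q.eq_zero_of_infinite_isRoot ((Set.Icc_infinite hab).mono h))
  exact (intervalIntegral.integral_pos hab (q.continuous.mul q.continuous).continuousOn
    (fun x _ ↦ mul_self_nonneg _)
    ⟨c, hc, mul_self_pos.mpr hqc⟩).ne'

theorem exists_derivative_eq (q : ℝ[X]) :
    ∃ u : ℝ[X], u.natDegree ≤ q.natDegree + 1 ∧ derivative u = q := by
  refine ⟨∑ i ∈ range (q.natDegree + 1), monomial (i + 1) (q.coeff i / (i + 1)),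
    natDegree_sum_le_of_forall_le _ _ fun i hi ↦
      (natDegree_monomial_le _).trans (mem_range.mp hi), ?_⟩
  conv_rhs => rw [q.as_sum_range]
  rw [derivative_sum]
  refine sum_congr rfl fun i _ ↦ ?_
  rw [derivative_monomial, Nat.add_sub_cancel]
  congr 1
  push_cast
  field_simp

theorem integral_legendre_sum_mul (s : Finset ℕ) (c : ℕ → ℝ) (q : ℝ[X]) :
    ∫ x in (-1 : ℝ)..1, (∑ i ∈ s, C (c i) * legendre i).eval x * q.eval x =
      ∑ i ∈ s, c i * ∫ x in (-1 : ℝ)..1, (legendre i).eval x * q.eval x := by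
  simp only [eval_finsetSum, eval_mul, eval_C, sum_mul, mul_assoc]
  rw [intervalIntegral.integral_finsetSum
    fun i _ ↦ Continuous.intervalIntegrable (by fun_prop) _ _]
  simp only [intervalIntegral.integral_const_mul]

/-- The GLSFR condition of order `p` says that the Legendre coefficients below `p` vanish. -/
theorem glsfrCondition_legendre_sum_iff {p N : ℕ} (hN : p ≤ N) (c : ℕ → ℝ) :
    GLSFRCondition p (∑ i ∈ range N, C (c i) * legendre i) ↔ ∀ k < p, c k = 0 := by
  refine ⟨fun H k hk ↦ ?_, fun H u hu ↦ ?_⟩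
  · obtain ⟨u, hu, hu'⟩ := exists_derivative_eq (legendre k)
    have hint := H u (hu.trans ((Nat.succ_le_succ (natDegree_legendre_le k)).trans hk))
    rw [hu', integral_legendre_sum_mul, sum_eq_single_of_mem k (mem_range.mpr (hk.trans_le hN))
      fun i _ hi ↦ by rw [integral_legendre_mul_legendre_of_ne hi, mul_zero]] at hint
    exact (mul_eq_zero.mp hint).resolve_right
      (integral_eval_mul_self_ne_zero (by norm_num) (legendre_ne_zero k))
  · rw [integral_legendre_sum_mul]
    refine sum_eq_zero fun i _ ↦ ?_
    rcases lt_or_ge i p with hi | hi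
    · rw [H i hi, zero_mul]
    · rw [integral_legendre_mul_eq_zero, mul_zero]
      by_cases hu0 : u = 0
      · simp [hu0]
      · exact (degree_derivative_lt hu0).trans_le
          (degree_le_of_natDegree_le (hu.trans hi))

theorem alternating_partial_sums_eq_zero_iff (p : ℕ) (c : ℕ → ℝ) :
    (∀ m : ℕ, 1 ≤ m → m ≤ p → ∑ i ∈ (range m).filter (fun i => Odd (i + m)), c i = 0) ↔
      ∀ k < p, c k = 0 := by
  refine ⟨fun H k ↦ ?_, fun H m _ hm ↦ sum_eq_zero fun i hi ↦
    H i ((mem_range.mp (mem_filter.mp hi).1).trans_le hm)⟩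
  induction k using Nat.strong_induction_on with
  | _ k ih =>
    intro hk
    rw [← H (k + 1) k.succ_pos hk]
    refine (sum_eq_single_of_mem k ?_ fun i hi hik ↦ ?_).symm
    · simp [← add_assoc, ← two_mul]
    · have := mem_range.mp (mem_filter.mp hi).1
      exact ih i (by omega) (by omega)

theorem glsfr_iff_alternating_partial_sums (p : ℕ) (hp : 1 ≤ p) (ht : ℕ → ℝ)
    (h : Polynomial ℝ)
    (hh : h = ∑ i ∈ Finset.range (p + 2), Polynomial.C (ht i) * legendre i) :
    GLSFRCondition p h ↔
      ∀ m : ℕ, 1 ≤ m → m ≤ p →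
        (∑ i ∈ (Finset.range m).filter (fun i => Odd (i + m)), ht i) = 0 := by
  rw [hh, glsfrCondition_legendre_sum_iff (by omega), alternating_partial_sums_eq_zero_iff]
end

section
/- Let p ≥ 1, let N ≥ 1, and for each n ∈ ℤ/Nℤ let u_n be a real polynomial of degree at most p. Let h_L, h_R be real polynomials with h_L(−1) = 1, h_L(1) = 0, h_R(−1) = 0, h_R(1) = 1, each satisfying the GLSFR condition of order p. For an upwinding ratio α ∈ ℝ, define the common interface value between elements n and n+1 as u^I_n = α u_n(1) + (1 − α) u_{n+1}(−1), and define w_n = −u_n' − (u^I_{n−1} − u_n(−1)) h_L' − (u^I_n − u_n(1)) h_R'. Then Σ_{n ∈ ℤ/Nℤ} ∫_{-1}^{1} u_n(ξ) w_n(ξ) dξ = −(α − 1/2) Σ_{n ∈ ℤ/Nℤ} (u_n(−1) − u_{n−1}(1))². -/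
open Polynomial Finset

theorem Polynomial.integral_mul_derivative (q r : ℝ[X]) (a b : ℝ) :
    ∫ ξ in a..b, q.eval ξ * (derivative r).eval ξ =
      q.eval b * r.eval b - q.eval a * r.eval a -
        ∫ ξ in a..b, (derivative q).eval ξ * r.eval ξ :=
  intervalIntegral.integral_mul_deriv_eq_deriv_mul (fun x _ => q.hasDerivAt x)
    (fun x _ => r.hasDerivAt x) ((derivative q).continuous.intervalIntegrable a b)
    ((derivative r).continuous.intervalIntegrable a b)

theorem GLSFRCondition.integral_mul_derivative {p : ℕ} {h : ℝ[X]} (hh : GLSFRCondition p h)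
    {v : ℝ[X]} (hv : v.natDegree ≤ p) :
    ∫ ξ in (-1 : ℝ)..1, v.eval ξ * (derivative h).eval ξ =
      v.eval 1 * h.eval 1 - v.eval (-1) * h.eval (-1) := by
  have key := hh v hv
  simp_rw [mul_comm (h.eval _)] at key
  rw [Polynomial.integral_mul_derivative, key, sub_zero]

theorem glsfr_periodic_energy_rate (p N : ℕ) (hp : 1 ≤ p) [NeZero N]
    (u : ZMod N → Polynomial ℝ) (hu : ∀ n, (u n).natDegree ≤ p)
    (hL hR : Polynomial ℝ)
    (hbcL1 : hL.eval (-1 : ℝ) = 1) (hbcL2 : hL.eval (1 : ℝ) = 0)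
    (hbcR1 : hR.eval (-1 : ℝ) = 0) (hbcR2 : hR.eval (1 : ℝ) = 1)
    (hstabL : GLSFRCondition p hL) (hstabR : GLSFRCondition p hR)
    (α : ℝ) (uI : ZMod N → ℝ)
    (huI : ∀ n, uI n = α * (u n).eval (1 : ℝ) + (1 - α) * (u (n + 1)).eval (-1 : ℝ))
    (w : ZMod N → Polynomial ℝ)
    (hw : ∀ n, w n = -Polynomial.derivative (u n)
        - Polynomial.C (uI (n - 1) - (u n).eval (-1 : ℝ)) * Polynomial.derivative hL
        - Polynomial.C (uI n - (u n).eval (1 : ℝ)) * Polynomial.derivative hR) :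
    (∑ n : ZMod N, ∫ ξ in (-1:ℝ)..1, (u n).eval ξ * (w n).eval ξ) =
      -(α - 1 / 2) * ∑ n : ZMod N, ((u n).eval (-1 : ℝ) - (u (n - 1)).eval (1 : ℝ)) ^ 2 := by
  have local_rate (n : ZMod N) : ∫ ξ in (-1 : ℝ)..1, (u n).eval ξ * (w n).eval ξ =
      (((u n).eval 1) ^ 2 / 2 - uI n * (u n).eval 1)
        - (((u n).eval (-1)) ^ 2 / 2 - uI (n - 1) * (u n).eval (-1)) := by
    have hself := Polynomial.integral_mul_derivative (u n) (u n) (-1) 1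
    simp_rw [mul_comm ((derivative (u n)).eval _)] at hself
    have hleft := hstabL.integral_mul_derivative (hu n)
    have hright := hstabR.integral_mul_derivative (hu n)
    rw [hbcL1, hbcL2] at hleft
    rw [hbcR1, hbcR2] at hright
    have hint (q : ℝ[X]) (c : ℝ) : IntervalIntegrable
        (fun ξ => c * ((u n).eval ξ * q.eval ξ)) MeasureTheory.volume (-1) 1 :=
      (continuous_const.mul ((u n).continuous.mul q.continuous)).intervalIntegrable _ _
    have hsplit (ξ : ℝ) : (u n).eval ξ * (w n).eval ξ =
        (-1) * ((u n).eval ξ * (derivative (u n)).eval ξ)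
          - (uI (n - 1) - (u n).eval (-1)) * ((u n).eval ξ * (derivative hL).eval ξ)
          - (uI n - (u n).eval 1) * ((u n).eval ξ * (derivative hR).eval ξ) := by
      rw [hw]
      simp only [eval_sub, eval_neg, eval_mul, eval_C]
      ring
    simp_rw [hsplit]
    rw [intervalIntegral.integral_sub ((hint _ _).sub (hint _ _)) (hint _ _),
      intervalIntegral.integral_sub (hint _ _) (hint _ _)]
    simp only [intervalIntegral.integral_const_mul]
    rw [hleft, hright]
    linear_combination (-1 / 2) * hself
  have hshift := Equiv.sum_comp (Equiv.subRight (1 : ZMod N))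
    (fun n => ((u n).eval 1) ^ 2 / 2 - uI n * (u n).eval 1)
  simp only [Equiv.subRight_apply] at hshift
  simp_rw [local_rate]
  rw [sum_sub_distrib, ← hshift, ← sum_sub_distrib, mul_sum]
  refine sum_congr rfl fun n _ => ?_
  rw [huI (n - 1), sub_add_cancel]
  ring
end

section
/- Let p ≥ 1, let N ≥ 1, and for each n ∈ ℤ/Nℤ let u_n be a real polynomial of degree at most p. Let h_L, h_R be real polynomials with h_L(−1) = 1, h_L(1) = 0, h_R(−1) = 0, h_R(1) = 1, each satisfying the GLSFR condition of order p. For an upwinding ratio α ≥ 1/2, define the common interface value between elements n and n+1 as u^I_n = α u_n(1) + (1 − α) u_{n+1}(−1), and define w_n = −u_n' − (u^I_{n−1} − u_n(−1)) h_L' − (u^I_n − u_n(1)) h_R'. Then Σ_{n ∈ ℤ/Nℤ} ∫_{-1}^{1} u_n(ξ) w_n(ξ) dξ ≤ 0; that is, the scheme is energy stable in the broken Lebesgue norm. -/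
open Polynomial Finset

/-- Integration by parts for real polynomials. -/
theorem Polynomial.integral_eval_mul_eval_derivative (f g : Polynomial ℝ) (a b : ℝ) :
    ∫ ξ in a..b, f.eval ξ * g.derivative.eval ξ =
      f.eval b * g.eval b - f.eval a * g.eval a -
        ∫ ξ in a..b, g.eval ξ * f.derivative.eval ξ := by
  rw [intervalIntegral.integral_mul_deriv_eq_deriv_mul (fun x _ => f.hasDerivAt x)
    (fun x _ => g.hasDerivAt x) (f.derivative.continuous.intervalIntegrable _ _)
    (g.derivative.continuous.intervalIntegrable _ _)]
  simp only [mul_comm]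

/-- A GLSFR correction function acts on polynomials of degree at most `p` through its boundary
values only. -/
theorem GLSFRCondition.integral_eval_mul_derivative {p : ℕ} {h f : Polynomial ℝ}
    (hh : GLSFRCondition p h) (hf : f.natDegree ≤ p) :
    ∫ ξ in (-1:ℝ)..1, f.eval ξ * h.derivative.eval ξ =
      f.eval 1 * h.eval 1 - f.eval (-1) * h.eval (-1) := by
  rw [f.integral_eval_mul_eval_derivative h, hh f hf, sub_zero]

/-- The energy rate of one element depends only on its boundary and interface values. -/
theorem GLSFRCondition.integral_eval_mul_rhs {p : ℕ} {f hL hR : Polynomial ℝ}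
    (hf : f.natDegree ≤ p)
    (hbcL1 : hL.eval (-1 : ℝ) = 1) (hbcL2 : hL.eval (1 : ℝ) = 0)
    (hbcR1 : hR.eval (-1 : ℝ) = 0) (hbcR2 : hR.eval (1 : ℝ) = 1)
    (hstabL : GLSFRCondition p hL) (hstabR : GLSFRCondition p hR) (l r : ℝ) :
    ∫ ξ in (-1:ℝ)..1, f.eval ξ * (-derivative f - C (l - f.eval (-1 : ℝ)) * derivative hL
        - C (r - f.eval (1 : ℝ)) * derivative hR).eval ξ =
      (f.eval 1 ^ 2 / 2 - r * f.eval 1) - (f.eval (-1) ^ 2 / 2 - l * f.eval (-1)) := by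
  have hint (g : Polynomial ℝ) (c : ℝ) : IntervalIntegrable
      (fun ξ => c * (f.eval ξ * g.eval ξ)) MeasureTheory.volume (-1) 1 :=
    (continuous_const.mul (f.continuous.mul g.continuous)).intervalIntegrable _ _
  have hsplit : (fun ξ => f.eval ξ * (-derivative f - C (l - f.eval (-1 : ℝ)) * derivative hL
        - C (r - f.eval (1 : ℝ)) * derivative hR).eval ξ) = fun ξ =>
      (-1) * (f.eval ξ * f.derivative.eval ξ)
        - (l - f.eval (-1)) * (f.eval ξ * hL.derivative.eval ξ)
        - (r - f.eval 1) * (f.eval ξ * hR.derivative.eval ξ) := by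
    funext ξ
    simp only [eval_sub, eval_neg, eval_mul, eval_C]
    ring
  rw [hsplit, intervalIntegral.integral_sub ((hint _ _).sub (hint _ _)) (hint _ _),
    intervalIntegral.integral_sub (hint _ _) (hint _ _)]
  simp only [intervalIntegral.integral_const_mul]
  rw [hstabL.integral_eval_mul_derivative hf, hstabR.integral_eval_mul_derivative hf,
    hbcL1, hbcL2, hbcR1, hbcR2]
  linear_combination (-1 / 2 : ℝ) * f.integral_eval_mul_eval_derivative f (-1) 1

theorem glsfr_periodic_energy_stability (p N : ℕ) (hp : 1 ≤ p) [NeZero N]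
    (u : ZMod N → Polynomial ℝ) (hu : ∀ n, (u n).natDegree ≤ p)
    (hL hR : Polynomial ℝ)
    (hbcL1 : hL.eval (-1 : ℝ) = 1) (hbcL2 : hL.eval (1 : ℝ) = 0)
    (hbcR1 : hR.eval (-1 : ℝ) = 0) (hbcR2 : hR.eval (1 : ℝ) = 1)
    (hstabL : GLSFRCondition p hL) (hstabR : GLSFRCondition p hR)
    (α : ℝ) (hα : 1 / 2 ≤ α) (uI : ZMod N → ℝ)
    (huI : ∀ n, uI n = α * (u n).eval (1 : ℝ) + (1 - α) * (u (n + 1)).eval (-1 : ℝ))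
    (w : ZMod N → Polynomial ℝ)
    (hw : ∀ n, w n = -Polynomial.derivative (u n)
        - Polynomial.C (uI (n - 1) - (u n).eval (-1 : ℝ)) * Polynomial.derivative hL
        - Polynomial.C (uI n - (u n).eval (1 : ℝ)) * Polynomial.derivative hR) :
    (∑ n : ZMod N, ∫ ξ in (-1:ℝ)..1, (u n).eval ξ * (w n).eval ξ) ≤ 0 := by
  simp only [hw, GLSFRCondition.integral_eval_mul_rhs (hu _) hbcL1 hbcL2 hbcR1 hbcR2
    hstabL hstabR]
  have hshift : ∑ n, ((u n).eval (-1) ^ 2 / 2 - uI (n - 1) * (u n).eval (-1)) =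
      ∑ n, ((u (n + 1)).eval (-1) ^ 2 / 2 - uI n * (u (n + 1)).eval (-1)) := by
    rw [← Equiv.sum_comp (Equiv.addRight (1 : ZMod N))]
    simp only [Equiv.coe_addRight, add_sub_cancel_right]
  rw [sum_sub_distrib, hshift, ← sum_sub_distrib]
  refine sum_nonpos fun n _ => ?_
  rw [huI]
  nlinarith [mul_nonneg (sub_nonneg.2 hα) (sq_nonneg ((u n).eval 1 - (u (n + 1)).eval (-1)))]
end

section
/- Let p ≥ 1 and let η be a real number with η ≠ −1. Define the OSFR left correction function h_L = ((−1)^p / 2) [ P_p − (η P_{p−1} + P_{p+1}) / (1 + η) ]. Then h_L satisfies the GLSFR condition of order p if and only if η = 0, i.e. if and only if h_L is the nodal Discontinuous Galerkin correction ((−1)^p / 2)(P_p − P_{p+1}). Hence the only member of the OSFR family of correction functions that lies in the GLSFR family is nodal DG. -/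
open Polynomial

open intervalIntegral

theorem integral_eval_derivative_mul (f q : Polynomial ℝ) (a b : ℝ)
    (ha : f.eval a = 0) (hb : f.eval b = 0) :
    (∫ x in a..b, (derivative f).eval x * q.eval x) =
      -∫ x in a..b, f.eval x * (derivative q).eval x := by
  have h := integral_mul_deriv_eq_deriv_mul (a := a) (b := b)
    (fun x _ => f.hasDerivAt x) (fun x _ => q.hasDerivAt x)
    (Continuous.intervalIntegrable (by fun_prop) _ _)
    (Continuous.intervalIntegrable (by fun_prop) _ _)
  rw [h, ha, hb]
  ring

theorem eval_iterate_derivative_pow_eq_zero {f : Polynomial ℝ} {x : ℝ} (hx : f.eval x = 0)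
    {k n : ℕ} (hk : k < n) : (derivative^[k] (f ^ n)).eval x = 0 := by
  have h : f ∣ derivative^[k] (f ^ n) :=
    (dvd_pow_self f (by omega)).trans (pow_sub_dvd_iterate_derivative_pow f n k)
  exact eval_eq_zero_of_dvd_of_eval_eq_zero h hx

theorem integral_eval_iterate_derivative_pow_mul {f : Polynomial ℝ} {a b : ℝ}
    (ha : f.eval a = 0) (hb : f.eval b = 0) {k n : ℕ} (hk : k ≤ n) (q : Polynomial ℝ) :
    (∫ x in a..b, (derivative^[k] (f ^ n)).eval x * q.eval x) =
      (-1) ^ k * ∫ x in a..b, (f ^ n).eval x * (derivative^[k] q).eval x := by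
  induction k generalizing q with
  | zero => simp
  | succ k ih =>
    rw [Function.iterate_succ_apply', Function.iterate_succ_apply,
      integral_eval_derivative_mul _ _ _ _ (eval_iterate_derivative_pow_eq_zero ha (by omega))
        (eval_iterate_derivative_pow_eq_zero hb (by omega)), ih (by omega)]
    ring

theorem integral_legendre_mul (n : ℕ) (q : Polynomial ℝ) :
    (∫ x in (-1 : ℝ)..1, (legendre n).eval x * q.eval x) =
      1 / (2 ^ n * n.factorial) *
        ((-1) ^ n * ∫ x in (-1 : ℝ)..1, (x ^ 2 - 1) ^ n * (derivative^[n] q).eval x) := by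
  have h := integral_eval_iterate_derivative_pow_mul (f := X ^ 2 - 1) (a := -1) (b := 1)
    (by simp) (by simp) (le_refl n) q
  simp only [eval_pow, eval_sub, eval_X, eval_one] at h
  rw [← h, ← integral_const_mul]
  simp only [legendre, eval_mul, eval_C, mul_assoc]

theorem integral_legendre_mul_of_natDegree_lt {n : ℕ} {q : Polynomial ℝ} (hq : q.natDegree < n) :
    (∫ x in (-1 : ℝ)..1, (legendre n).eval x * q.eval x) = 0 := by
  rw [integral_legendre_mul, iterate_derivative_eq_zero hq]
  simp

theorem integral_legendre_mul_X_pow_ne_zero (n : ℕ) :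
    (∫ x in (-1 : ℝ)..1, (legendre n).eval x * (X ^ n : Polynomial ℝ).eval x) ≠ 0 := by
  have hpos : 0 < ∫ x in (-1 : ℝ)..1, (1 - x ^ 2) ^ n := by
    refine intervalIntegral_pos_of_pos_on (Continuous.intervalIntegrable (by fun_prop) _ _)
      (fun x hx => pow_pos ?_ n) (by norm_num)
    nlinarith [hx.1, hx.2]
  have hsign : ∀ x : ℝ, (x ^ 2 - 1) ^ n = (-1) ^ n * (1 - x ^ 2) ^ n := fun x => by
    rw [← mul_pow]
    ring
  rw [integral_legendre_mul, iterate_derivative_X_pow_eq_natCast_mul]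
  simp only [hsign, Nat.descFactorial_self, Nat.sub_self, pow_zero, mul_one, eval_natCast,
    integral_mul_const, integral_const_mul]
  have := n.factorial_ne_zero
  have := hpos.ne'
  positivity

theorem integral_osfr_mul {p : ℕ} (η : ℝ) {q : Polynomial ℝ} (hq : q.natDegree < p) :
    (∫ x in (-1 : ℝ)..1, (C ((-1 : ℝ) ^ p / 2) *
        (legendre p - C (1 / (1 + η)) * (C η * legendre (p - 1) + legendre (p + 1)))).eval x *
          q.eval x) =
      -((-1) ^ p / 2 * (η / (1 + η))) *
        ∫ x in (-1 : ℝ)..1, (legendre (p - 1)).eval x * q.eval x := by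
  have hint (n : ℕ) : IntervalIntegrable (fun x => (legendre n).eval x * q.eval x)
      MeasureTheory.volume (-1) 1 := Continuous.intervalIntegrable (by fun_prop) _ _
  have hexpand : ∀ x : ℝ, (C ((-1 : ℝ) ^ p / 2) *
        (legendre p - C (1 / (1 + η)) * (C η * legendre (p - 1) + legendre (p + 1)))).eval x *
          q.eval x = (-1) ^ p / 2 * ((legendre p).eval x * q.eval x) -
        ((-1) ^ p / 2 * (η / (1 + η)) * ((legendre (p - 1)).eval x * q.eval x) +
          (-1) ^ p / 2 * (1 / (1 + η)) * ((legendre (p + 1)).eval x * q.eval x)) := fun x => by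
    simp only [eval_mul, eval_sub, eval_add, eval_C]
    ring
  simp only [hexpand]
  rw [integral_sub ((hint _).const_mul _) (((hint _).const_mul _).add ((hint _).const_mul _)),
    integral_add ((hint _).const_mul _) ((hint _).const_mul _)]
  simp only [integral_const_mul, integral_legendre_mul_of_natDegree_lt hq,
    integral_legendre_mul_of_natDegree_lt (hq.trans p.lt_succ_self)]
  ring

theorem osfr_glsfr_intersection_is_dg (p : ℕ) (hp : 1 ≤ p) (η : ℝ) (hη : η ≠ -1)
    (hL : Polynomial ℝ)
    (hdef : hL = Polynomial.C ((-1 : ℝ) ^ p / 2) *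
        (legendre p - Polynomial.C (1 / (1 + η)) *
          (Polynomial.C η * legendre (p - 1) + legendre (p + 1)))) :
    (GLSFRCondition p hL ↔ η = 0) ∧
    (GLSFRCondition p hL ↔
      hL = Polynomial.C ((-1 : ℝ) ^ p / 2) * (legendre p - legendre (p + 1))) := by
  have hdeg {u : Polynomial ℝ} (hu : u.natDegree ≤ p) : (derivative u).natDegree < p :=
    (natDegree_derivative_le u).trans_lt (by omega)
  have hη' : 1 + η ≠ 0 := fun h => hη (by linarith)
  have hzero : GLSFRCondition p hL ↔ η = 0 := by
    subst hdef
    constructor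
    · intro h
      have hX := h (X ^ p) (natDegree_X_pow_le p)
      rw [integral_osfr_mul η (hdeg (natDegree_X_pow_le p)), derivative_X_pow] at hX
      simp only [eval_mul, eval_C, mul_left_comm _ (p : ℝ), integral_const_mul] at hX
      have hne := integral_legendre_mul_X_pow_ne_zero (p - 1)
      simp only [eval_pow, eval_X] at hne
      have hp' : (p : ℝ) ≠ 0 := by positivity
      simpa [hne, hp', hη'] using hX
    · rintro rfl u hu
      rw [integral_osfr_mul 0 (hdeg hu)]
      simp
  refine ⟨hzero, fun h => ?_, fun h u hu => ?_⟩
  · rw [hdef, hzero.1 h]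
    simp
  · have hosfr := integral_osfr_mul 0 (hdeg hu)
    simpa [h] using hosfr
end
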